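/- (Verification of Theorem 1, variable–check part.) For every j ∈ {1,…,d−1}, the function δ_{l,r_j} is differentiable on (0, ∞) and satisfies, for all y > 0, d/dy δ_{l,r_j}(y) = ((b−1)/y)·( j·δ_{l,r_j}(y) + D_j(y) ), where D_j(y) = j·( b·ε·ε̃·( ē_{r_{j+1}}(y) − ē_{r_j}(y) )/ē_l(y) − 1_{j≠d−1}·δ_{l,r_{j+1}}(y) + 1_{j=d−1}·( Σ_{m=1}^{d−1} δ_{l,r_m}(y) − b·ε·ε̃ ) ). -/

import Mathlib

open Finset Filter

/-- `x(y) = ε·y^(b−1)`. -/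
noncomputable def xx (b : ℕ) (ε y : ℝ) : ℝ := ε * y ^ (b - 1)

/-- `G_j(y) = C(d−1,j−1)·x^(j−1)·x̃^(d−j−1)·(d·x − j) + 1_{j=1}` for `j ∈ {1,…,d−1}`. -/
noncomputable def G (b d : ℕ) (ε : ℝ) (j : ℕ) (y : ℝ) : ℝ :=
  (Nat.choose (d - 1) (j - 1) : ℝ) * xx b ε y ^ (j - 1) *
      (1 - xx b ε y) ^ (d - j - 1) * ((d : ℝ) * xx b ε y - (j : ℝ)) +
    (if j = 1 then (1 : ℝ) else 0)

/-- `G_d(y) = −d·x^(d−1)`. -/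
noncomputable def Gd (b d : ℕ) (ε y : ℝ) : ℝ := -(d : ℝ) * xx b ε y ^ (d - 1)

/-- `ē_l(y) = x·y`. -/
noncomputable def el (b : ℕ) (ε y : ℝ) : ℝ := xx b ε y * y

/-- `ē_{r_1}(y) = x·(y − 1 + x̃^(d−1))` and `ē_{r_j}(y) = C(d−1,j−1)·x^j·x̃^(d−j)` for `j ≥ 2`. -/
noncomputable def er (b d : ℕ) (ε : ℝ) (j : ℕ) (y : ℝ) : ℝ :=
  if j = 1 then xx b ε y * (y - 1 + (1 - xx b ε y) ^ (d - 1))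
  else (Nat.choose (d - 1) (j - 1) : ℝ) * xx b ε y ^ j * (1 - xx b ε y) ^ (d - j)

/-- `δ_{l,r_j}(y) = −G_j(y)·(ε·ε̃·(b−1)/y + ε̃·x) + 1_{j=1}·b·ε·ε̃`. -/
noncomputable def dlr (b d : ℕ) (ε : ℝ) (j : ℕ) (y : ℝ) : ℝ :=
  -(G b d ε j y) * (ε * (1 - ε) * ((b : ℝ) - 1) / y + (1 - ε) * xx b ε y) +
    (if j = 1 then (1 : ℝ) else 0) * ((b : ℝ) * ε * (1 - ε))

/-- The logarithmic derivative of `x(y) = ε·y^(b−1)` is `(b−1)/y`. -/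
theorem hasDerivAt_xx {b : ℕ} (hb : 1 ≤ b) (ε : ℝ) {y : ℝ} (hy : y ≠ 0) :
    HasDerivAt (xx b ε) (((b : ℝ) - 1) / y * xx b ε y) y := by
  obtain ⟨n, rfl⟩ := Nat.exists_eq_add_of_le' hb
  refine ((hasDerivAt_pow n y).const_mul ε).congr_deriv ?_
  cases n with
  | zero => simp
  | succ n =>
    simp only [xx, Nat.add_sub_cancel]
    push_cast
    field_simp
    ring

theorem cast_succ_mul_choose (n k : ℕ) :
    ((k : ℝ) + 1) * ((n + k + 1).choose (k + 1) : ℝ) = (n + 1) * ((n + k + 1).choose k : ℝ) := by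
  have h := Nat.choose_succ_right_eq (n + k + 1) k
  rw [show n + k + 1 - k = n + 1 by omega] at h
  have h' : ((n + k + 1).choose (k + 1) : ℝ) * (k + 1) = (n + k + 1).choose k * (n + 1) := by
    exact_mod_cast h
  linarith

/-- The polynomial `C·x^i·(1−x)^k·(a·x−c)` behind `G_j`, differentiated in `x`. -/
theorem mul_deriv_pow_mul_one_sub_pow (C a c : ℝ) (i k : ℕ) (x : ℝ) :
    ∃ p' : ℝ, HasDerivAt (fun x : ℝ => C * x ^ i * (1 - x) ^ k * (a * x - c)) p' x ∧
      x * p' = C * x ^ i * (i * (1 - x) ^ k * (a * x - c)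
        - k * x * (1 - x) ^ (k - 1) * (a * x - c) + a * x * (1 - x) ^ k) := by
  refine ⟨_, (((hasDerivAt_pow i x).const_mul C).mul
    (((hasDerivAt_id x).const_sub 1).pow k)).mul
      (((hasDerivAt_id x).const_mul a).sub_const c), ?_⟩
  cases i with
  | zero => simp; ring
  | succ i => simp; ring

/-- With `G_{j+1}` read as `G_d` for `j = d−1`, one has `(x·G_j)' = j·(G_j − G_{j+1})` in the
variable `x`; this is that identity in the variable `y`. -/
theorem hasDerivAt_G {b d : ℕ} (hb : 1 ≤ b) (ε : ℝ) {j : ℕ} (hj1 : 1 ≤ j) (hj2 : j ≤ d - 1)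
    {y : ℝ} (hy : y ≠ 0) :
    HasDerivAt (G b d ε j) (((b : ℝ) - 1) / y *
      (j * (G b d ε j y - if j = d - 1 then Gd b d ε y else G b d ε (j + 1) y) - G b d ε j y))
      y := by
  obtain ⟨i, rfl⟩ := Nat.exists_eq_add_of_le' hj1
  obtain ⟨k, rfl⟩ : ∃ k, d = k + i + 2 := ⟨d - i - 2, by omega⟩
  obtain ⟨p', hp, hp'⟩ := mul_deriv_pow_mul_one_sub_pow ((k + i + 1).choose i : ℝ)
    ((k + i + 2 : ℕ) : ℝ) ((i + 1 : ℕ) : ℝ) i k (xx b ε y)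
  have h := (hp.comp y (hasDerivAt_xx hb ε hy)).add_const (if i + 1 = 1 then (1 : ℝ) else 0)
  have hG : G b (k + i + 2) ε (i + 1) = fun z =>
      ((k + i + 1).choose i : ℝ) * xx b ε z ^ i * (1 - xx b ε z) ^ k *
        (((k + i + 2 : ℕ) : ℝ) * xx b ε z - ((i + 1 : ℕ) : ℝ)) +
          (if i + 1 = 1 then (1 : ℝ) else 0) := by
    funext z
    simp only [G, show k + i + 2 - 1 = k + i + 1 by omega, Nat.add_sub_cancel,
      show k + i + 2 - (i + 1) - 1 = k by omega]
  have hite : ((i : ℝ) + 1) * (if i + 1 = 1 then (1 : ℝ) else 0) =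
      if i + 1 = 1 then (1 : ℝ) else 0 := by
    rcases eq_or_ne i 0 with rfl | hi
    · simp
    · simp [hi]
  rw [show ((b : ℝ) - 1) / y * (((i + 1 : ℕ) : ℝ) * (G b (k + i + 2) ε (i + 1) y -
      if i + 1 = k + i + 2 - 1 then Gd b (k + i + 2) ε y else G b (k + i + 2) ε (i + 1 + 1) y) -
        G b (k + i + 2) ε (i + 1) y) = p' * (((b : ℝ) - 1) / y * xx b ε y) from ?_, hG]
  · exact h
  rw [show p' * (((b : ℝ) - 1) / y * xx b ε y) = ((b : ℝ) - 1) / y * (xx b ε y * p') by ring, hp',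
    hG]
  congr 1
  generalize (if i + 1 = 1 then (1 : ℝ) else 0) = c at hite
  have hchoose := cast_succ_mul_choose k i
  cases k with
  | zero =>
    have hC : ((0 + i + 1).choose i : ℝ) = i + 1 := by simp
    rw [if_pos (by omega), hC]
    simp only [Gd, show 0 + i + 2 - 1 = i + 1 by omega]
    push_cast
    linear_combination hite
  | succ k =>
    rw [if_neg (by omega)]
    simp only [G, show k + 1 + i + 2 - 1 = k + 1 + i + 1 by omega, Nat.add_sub_cancel,
      show k + 1 + i + 2 - (i + 1 + 1) - 1 = k by omega, if_neg (show i + 1 + 1 ≠ 1 by omega)]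
    push_cast at hchoose ⊢
    linear_combination hite - xx b ε y ^ (i + 1) * (1 - xx b ε y) ^ k *
      (((k : ℝ) + 1 + i + 2) * xx b ε y - (i + 1 + 1)) * hchoose

/-- `G_j` as a difference of consecutive binomial weights. -/
theorem G_eq_sub (b : ℕ) {d : ℕ} (ε : ℝ) {j : ℕ} (hj1 : 1 ≤ j) (hj2 : j ≤ d - 1) (y : ℝ) :
    G b d ε j y = j * ((Nat.choose (d - 1) j : ℝ) * xx b ε y ^ j * (1 - xx b ε y) ^ (d - 1 - j) -
      (Nat.choose (d - 1) (j - 1) : ℝ) * xx b ε y ^ (j - 1) * (1 - xx b ε y) ^ (d - j)) +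
        if j = 1 then (1 : ℝ) else 0 := by
  obtain ⟨i, rfl⟩ := Nat.exists_eq_add_of_le' hj1
  obtain ⟨k, rfl⟩ : ∃ k, d = k + i + 2 := ⟨d - i - 2, by omega⟩
  have hchoose := cast_succ_mul_choose k i
  simp only [G, show k + i + 2 - 1 = k + i + 1 by omega, Nat.add_sub_cancel,
    show k + i + 1 - (i + 1) = k by omega,
    show k + i + 2 - (i + 1) = k + 1 by omega]
  push_cast
  linear_combination -(xx b ε y ^ (i + 1) * (1 - xx b ε y) ^ k) * hchoose

theorem sum_range_succ_mul_sub (a : ℕ → ℝ) (n : ℕ) :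
    ∑ i ∈ range n, ((i : ℝ) + 1) * (a (i + 1) - a i) = (n + 1) * a n - ∑ i ∈ range (n + 1), a i := by
  induction n with
  | zero => simp
  | succ n ih =>
    rw [sum_range_succ, ih, sum_range_succ a (n + 1)]
    push_cast
    ring

theorem sum_G (b : ℕ) {d : ℕ} (hd : 2 ≤ d) (ε y : ℝ) :
    ∑ m ∈ Icc 1 (d - 1), G b d ε m y = -Gd b d ε y := by
  obtain ⟨n, rfl⟩ := Nat.exists_eq_add_of_le' hd
  set x := xx b ε y with hx
  let a : ℕ → ℝ := fun i => ((n + 1).choose i : ℝ) * x ^ i * (1 - x) ^ (n + 1 - i)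
  have ha : ∑ i ∈ range (n + 1 + 1), a i = 1 := by
    have h := add_pow x (1 - x) (n + 1)
    rw [add_sub_cancel, one_pow] at h
    rw [h]
    exact sum_congr rfl fun i _ => by simp only [a]; ring
  have hG : ∀ i ∈ range (n + 1), G b (n + 2) ε (1 + i) y =
      ((i : ℝ) + 1) * (a (i + 1) - a i) + if i = 0 then (1 : ℝ) else 0 := by
    intro i hi
    rw [mem_range] at hi
    rw [G_eq_sub b ε (by omega) (by omega), add_comm 1 i]
    simp only [a, ← hx, Nat.add_sub_cancel, show n + 2 - 1 = n + 1 by omega,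
      show n + 2 - (i + 1) = n + 1 - i by omega, Nat.add_eq_right]
    push_cast
    rfl
  rw [show n + 2 - 1 = n + 1 by omega, ← Finset.Ico_add_one_right_eq_Icc, sum_Ico_eq_sum_range,
    Nat.add_sub_cancel, sum_congr rfl hG, sum_add_distrib, sum_range_succ_mul_sub, ha]
  simp [a, Gd, ← hx]
  ring

/-- `j·(ē_{r_{j+1}} − ē_{r_j})/ē_l = G_j/y − 1_{j=1}`. -/
theorem mul_er_sub_er_div_el (b : ℕ) {d : ℕ} (ε : ℝ) {j : ℕ} (hj1 : 1 ≤ j) (hj2 : j ≤ d - 1)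
    {y : ℝ} (hy : y ≠ 0) (hx : xx b ε y ≠ 0) :
    (j : ℝ) * ((er b d ε (j + 1) y - er b d ε j y) / el b ε y) =
      G b d ε j y / y - if j = 1 then (1 : ℝ) else 0 := by
  rw [G_eq_sub b ε hj1 hj2]
  obtain ⟨i, rfl⟩ := Nat.exists_eq_add_of_le' hj1
  simp only [er, el, if_neg (show i + 1 + 1 ≠ 1 by omega), Nat.add_sub_cancel,
    show d - (i + 1 + 1) = d - 1 - (i + 1) by omega]
  rcases eq_or_ne i 0 with rfl | hi
  · simp
    field_simp
    ring
  · simp only [if_neg (show i + 1 ≠ 1 by omega)]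
    field_simp
    ring

/-- Verification of Theorem 1, variable–check part: for `j ∈ {1,…,d−1}` the function
`δ_{l,r_j}` is differentiable on `(0,∞)` with
`d/dy δ_{l,r_j}(y) = ((b−1)/y)·(j·δ_{l,r_j}(y) + D_j(y))`. -/
theorem dlr_hasDerivAt (b d : ℕ) (hb : 2 ≤ b) (hd : 2 ≤ d) (ε : ℝ)
    (hε0 : 0 < ε) (hε1 : ε < 1) (j : ℕ) (hj1 : 1 ≤ j) (hj2 : j ≤ d - 1)
    (y : ℝ) (hy : 0 < y) :
    HasDerivAt (dlr b d ε j)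
      ((((b : ℝ) - 1) / y) *
        ((j : ℝ) * dlr b d ε j y +
          (j : ℝ) *
            ((b : ℝ) * ε * (1 - ε) * (er b d ε (j + 1) y - er b d ε j y) / el b ε y -
              (if j ≠ d - 1 then (1 : ℝ) else 0) * dlr b d ε (j + 1) y +
              (if j = d - 1 then (1 : ℝ) else 0) *
                ((∑ m ∈ Finset.Icc 1 (d - 1), dlr b d ε m y) - (b : ℝ) * ε * (1 - ε))))) y := by
  have hy0 : y ≠ 0 := hy.ne'
  have hx : xx b ε y ≠ 0 := by unfold xx; positivity
  have hsum : (∑ m ∈ Icc 1 (d - 1), dlr b d ε m y) - (b : ℝ) * ε * (1 - ε) =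
      Gd b d ε y * (ε * (1 - ε) * ((b : ℝ) - 1) / y + (1 - ε) * xx b ε y) := by
    have h1 : ∑ m ∈ Icc 1 (d - 1), (if m = 1 then (1 : ℝ) else 0) = 1 := by
      rw [sum_ite_eq', if_pos (mem_Icc.2 ⟨le_rfl, by omega⟩)]
    simp only [dlr]
    rw [sum_add_distrib, ← sum_mul, ← sum_mul, sum_neg_distrib, sum_G b hd, h1]
    ring
  have hnext : -(if j ≠ d - 1 then (1 : ℝ) else 0) * dlr b d ε (j + 1) y +
      (if j = d - 1 then (1 : ℝ) else 0) *
        ((∑ m ∈ Icc 1 (d - 1), dlr b d ε m y) - (b : ℝ) * ε * (1 - ε)) =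
      (if j = d - 1 then Gd b d ε y else G b d ε (j + 1) y) *
        (ε * (1 - ε) * ((b : ℝ) - 1) / y + (1 - ε) * xx b ε y) := by
    rw [hsum]
    by_cases h : j = d - 1
    · simp [h]
    · simp [h, dlr, show j ≠ 0 by omega]
  have he := mul_er_sub_er_div_el b ε hj1 hj2 hy0 hx
  have hW : HasDerivAt (fun z => ε * (1 - ε) * ((b : ℝ) - 1) / z + (1 - ε) * xx b ε z)
      (((b : ℝ) - 1) / y * ((1 - ε) * xx b ε y - ε * (1 - ε) / y)) y := by
    refine (((hasDerivAt_inv hy0).const_mul (ε * (1 - ε) * ((b : ℝ) - 1))).add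
      ((hasDerivAt_xx (by omega) ε hy0).const_mul (1 - ε))).congr_deriv ?_
    field_simp
    ring
  have hj : (j : ℝ) * (if j = 1 then (1 : ℝ) else 0) = if j = 1 then (1 : ℝ) else 0 := by
    split_ifs with h <;> simp [h]
  refine (((hasDerivAt_G (by omega) ε hj1 hj2 hy0).neg.mul hW).add_const
    ((if j = 1 then (1 : ℝ) else 0) * ((b : ℝ) * ε * (1 - ε)))).congr_deriv ?_
  rw [Pi.neg_apply, dlr]
  linear_combination -((b : ℝ) - 1) / y *
    ((b : ℝ) * ε * (1 - ε) * he + j * hnext + (b : ℝ) * ε * (1 - ε) * hj)
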